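/- There is an absolute constant C > 0 such that the following holds. Let q and k be integers with 3 ≤ k ≤ (log q)/(400·log log q), let y and z be reals with k³ ≤ y ≤ z ≤ q^{11/21}, and let 𝒜 be any subset of {n ∈ ℕ : y < n ≤ z and P⁻(n) > y}. Then (1/φ(q))·∑_{χ mod q} S_𝒜(χ)^{2k} ≤ C·(y^{−k/21} + q^{−1/10}), and moreover (1/φ(q))·∑_{χ mod q} S_𝒜(χ)^{2k} ≤ C/(log y)^{40k}. -/

import Mathlib

open Real Complex MeasureTheory
open scoped BigOperators

attribute [local instance] Classical.propDecidable

/-- `e(x) = exp(2πix)` -/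
noncomputable def e2pi (x : ℝ) : ℂ := Complex.exp (2 * Real.pi * Complex.I * x)

/-- `∑_{n ≤ x} χ(n)` -/
noncomputable def charSum {q : ℕ} (χ : DirichletCharacter ℂ q) (x : ℝ) : ℂ :=
  ∑ n ∈ Finset.Icc 1 ⌊x⌋₊, χ (n : ZMod q)

/-- `M(χ) = max_{1 ≤ N ≤ q} |∑_{n ≤ N} χ(n)|` -/
noncomputable def Mchi {q : ℕ} (χ : DirichletCharacter ℂ q) : ℝ :=
  ⨆ N ∈ Finset.Icc 1 q, ‖charSum χ (N : ℝ)‖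

/-- `m(χ) = π M(χ)/(e^γ √q)` -/
noncomputable def mchi {q : ℕ} (χ : DirichletCharacter ℂ q) : ℝ :=
  Real.pi * Mchi χ / (Real.exp Real.eulerMascheroniConstant * Real.sqrt q)

/-- the modified Bessel function `I₀` -/
noncomputable def I0 (t : ℝ) : ℝ := ∑' n : ℕ, (t ^ 2 / 4) ^ n / ((n.factorial : ℝ)) ^ 2

/-- the constant `A` -/
noncomputable def Aconst : ℝ :=
  Real.log 2 - 1 - (∫ t in (0:ℝ)..2, Real.log (I0 t) / t ^ 2)
    - ∫ t in Set.Ioi (2:ℝ), (Real.log (I0 t) - t) / t ^ 2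

/-- `Φ_q(τ)` -/
noncomputable def Phi (q : ℕ) (τ : ℝ) : ℝ :=
  (Nat.card {χ : DirichletCharacter ℂ q // χ ≠ 1 ∧ τ < mchi χ} : ℝ) / q.totient

/-- `S_𝒜(χ) = max_{α ∈ [0,1]} |∑_{n ∈ 𝒜} χ(n) e(nα)/n|` -/
noncomputable def SA {q : ℕ} (χ : DirichletCharacter ℂ q) (A : Finset ℕ) : ℝ :=
  ⨆ α : Set.Icc (0:ℝ) 1, ‖∑ n ∈ A, χ (n : ZMod q) * e2pi (n * (α : ℝ)) / n‖

/-- `S_{y,z}(χ)` -/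
noncomputable def Syz {q : ℕ} (χ : DirichletCharacter ℂ q) (y z : ℝ) : ℝ :=
  SA χ ((Finset.Icc 1 ⌊z⌋₊).filter fun n => ∃ p : ℕ, p.Prime ∧ p ∣ n ∧ y < (p : ℝ))

/-- `L(1,χ)` -/
noncomputable def Lone {q : ℕ} (χ : DirichletCharacter ℂ q) : ℂ :=
  ∑' n : ℕ, χ (n : ZMod q) / n

/-- the Gauss sum `G(χ) = ∑_{a=1}^{q} χ(a) e(a/q)` -/
noncomputable def gaussS {q : ℕ} (χ : DirichletCharacter ℂ q) : ℂ :=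
  ∑ a ∈ Finset.Icc 1 q, χ (a : ZMod q) * e2pi ((a : ℝ) / q)

/-- the pretentious distance `𝔻(χ, ξ; y)` -/
noncomputable def Ddist {q D : ℕ} (χ : DirichletCharacter ℂ q) (ξ : DirichletCharacter ℂ D)
    (y : ℝ) : ℝ :=
  Real.sqrt (∑ p ∈ (Finset.Icc 1 ⌊y⌋₊).filter Nat.Prime,
    (1 - (χ (p : ZMod q) * (starRingEnd ℂ) (ξ (p : ZMod D))).re) / p)

theorem card_finMulAntidiag_prime_mul_le (d : ℕ) {p m : ℕ} (hp : p.Prime) (hm : m ≠ 0) :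
    (Nat.finMulAntidiag d (p * m)).card ≤ d * (Nat.finMulAntidiag d m).card := by
  have hsurj : Set.SurjOn (fun x : Fin d × (Fin d → ℕ) => Function.update x.2 x.1 (p * x.2 x.1))
      ((Finset.univ : Finset (Fin d)) ×ˢ Nat.finMulAntidiag d m : Finset _)
      (Nat.finMulAntidiag d (p * m)) := by
    intro f hf
    have hf' := Nat.mem_finMulAntidiag.1 hf
    obtain ⟨i, -, j, hj⟩ := (Prime.dvd_finsetProd_iff hp.prime f).1
      (hf'.1 ▸ dvd_mul_right p m : p ∣ ∏ i, f i)
    refine ⟨(i, Function.update f i j), ?_, ?_⟩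
    · simp only [Finset.coe_product, Set.mem_prod, Finset.coe_univ, Set.mem_univ, true_and,
        Finset.mem_coe, Nat.mem_finMulAntidiag]
      refine ⟨?_, hm⟩
      have h1 : f = Function.update f i (p * j) := by rw [← hj, Function.update_eq_self]
      have h2 := hf'.1
      rw [h1, Finset.prod_update_of_mem (Finset.mem_univ i), mul_assoc] at h2
      rw [Finset.prod_update_of_mem (Finset.mem_univ i)]
      exact Nat.eq_of_mul_eq_mul_left hp.pos h2
    · simp [← hj]
  simpa using Finset.card_le_card_of_surjOn _ hsurj

/-- If every prime factor of `m` is at least `d ^ 3`, then `m` has at most `m ^ (1 / 3)` ordered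
factorizations into `d` factors. -/
theorem card_finMulAntidiag_pow_three_le (d : ℕ) {m : ℕ} (hm : m ≠ 0)
    (h : ∀ p : ℕ, p.Prime → p ∣ m → d ^ 3 ≤ p) : (Nat.finMulAntidiag d m).card ^ 3 ≤ m := by
  induction m using induction_on_primes with
  | zero => exact absurd rfl hm
  | one => simp [Nat.finMulAntidiag_one]
  | prime_mul p m hp ih =>
    have hm' : m ≠ 0 := right_ne_zero_of_mul hm
    calc (Nat.finMulAntidiag d (p * m)).card ^ 3
        ≤ (d * (Nat.finMulAntidiag d m).card) ^ 3 :=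
          Nat.pow_le_pow_left (card_finMulAntidiag_prime_mul_le d hp hm') 3
      _ = d ^ 3 * (Nat.finMulAntidiag d m).card ^ 3 := mul_pow _ _ _
      _ ≤ p * m := Nat.mul_le_mul (h p hp (dvd_mul_right p m))
          (ih hm' fun r hr hrm => h r hr (hrm.mul_left p))

theorem norm_sum_dirichletCharacter_mul_conj_le {q : ℕ} [NeZero q] (a b : ZMod q) :
    ‖∑ χ : DirichletCharacter ℂ q, χ a * (starRingEnd ℂ) (χ b)‖ ≤
      if a = b then (q.totient : ℝ) else 0 := by
  by_cases hb : IsUnit b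
  · have h : ∀ χ : DirichletCharacter ℂ q, χ a * (starRingEnd ℂ) (χ b) = χ b⁻¹ * χ a := by
      intro χ
      rw [mul_comm, starRingEnd_apply, MulChar.star_apply', MulChar.inv_apply, ← hb.unit_spec,
        Ring.inverse_unit, ZMod.inv_coe_unit]
    simp only [h, DirichletCharacter.sum_char_inv_mul_char_eq ℂ hb a, eq_comm (a := b)]
    split_ifs <;> simp
  · simp only [MulChar.map_nonunit _ hb, map_zero, mul_zero, Finset.sum_const_zero, norm_zero]
    split_ifs <;> simp

/-- Mean value estimate: a diagonal bound for the second moment over characters. -/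
theorem sum_norm_sq_dirichletCharacter_le {ι : Type*} {q : ℕ} [NeZero q] (T : Finset ι)
    (m : ι → ℕ) (c : ι → ℂ) {A D : ℝ} (hA : 0 ≤ A) (hc : ∀ t ∈ T, ‖c t‖ ≤ A)
    (hD : ∀ a : ZMod q, ((T.filter fun t => (m t : ZMod q) = a).card : ℝ) ≤ D) :
    ∑ χ : DirichletCharacter ℂ q, ‖∑ t ∈ T, χ (m t : ZMod q) * c t‖ ^ 2 ≤
      q.totient * (A ^ 2 * (T.card * D)) := by
  have key : ((∑ χ : DirichletCharacter ℂ q, ‖∑ t ∈ T, χ (m t : ZMod q) * c t‖ ^ 2 : ℝ) : ℂ) =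
      ∑ s ∈ T, ∑ t ∈ T, (c s * (starRingEnd ℂ) (c t)) *
        ∑ χ : DirichletCharacter ℂ q, χ (m s : ZMod q) * (starRingEnd ℂ) (χ (m t : ZMod q)) := by
    push_cast
    simp only [← Complex.mul_conj', map_sum, map_mul, Finset.sum_mul_sum]
    simp only [Finset.mul_sum]
    rw [Finset.sum_comm]
    refine Finset.sum_congr rfl fun s _ => ?_
    rw [Finset.sum_comm]
    refine Finset.sum_congr rfl fun t _ => Finset.sum_congr rfl fun χ _ => ?_
    ring
  have hnn : 0 ≤ ∑ χ : DirichletCharacter ℂ q, ‖∑ t ∈ T, χ (m t : ZMod q) * c t‖ ^ 2 := by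
    positivity
  rw [← Complex.norm_of_nonneg hnn, key]
  have hinner : ∀ s ∈ T, ∑ t ∈ T, ‖(c s * (starRingEnd ℂ) (c t)) *
        ∑ χ : DirichletCharacter ℂ q, χ (m s : ZMod q) * (starRingEnd ℂ) (χ (m t : ZMod q))‖ ≤
      A ^ 2 * (q.totient * D) := by
    intro s hs
    calc _ ≤ ∑ t ∈ T, A ^ 2 * (if (m t : ZMod q) = m s then (q.totient : ℝ) else 0) := by
          refine Finset.sum_le_sum fun t ht => ?_
          rw [norm_mul, norm_mul, RCLike.norm_conj, pow_two]
          refine mul_le_mul (mul_le_mul (hc s hs) (hc t ht) (norm_nonneg _) hA) ?_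
            (norm_nonneg _) (by positivity)
          simpa only [eq_comm] using
            norm_sum_dirichletCharacter_mul_conj_le (m s : ZMod q) (m t : ZMod q)
      _ = A ^ 2 * (q.totient * ((T.filter fun t => (m t : ZMod q) = m s).card : ℝ)) := by
          rw [← Finset.mul_sum, ← Finset.sum_filter, Finset.sum_const, nsmul_eq_mul, mul_comm
            ((Finset.card _ : ℕ) : ℝ)]
      _ ≤ _ := by gcongr; exact hD _
  calc _ ≤ ∑ s ∈ T, ∑ t ∈ T, ‖(c s * (starRingEnd ℂ) (c t)) *
        ∑ χ : DirichletCharacter ℂ q, χ (m s : ZMod q) * (starRingEnd ℂ) (χ (m t : ZMod q))‖ :=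
        (norm_sum_le _ _).trans (Finset.sum_le_sum fun s _ => norm_sum_le _ _)
    _ ≤ ∑ s ∈ T, A ^ 2 * (q.totient * D) := Finset.sum_le_sum hinner
    _ = _ := by rw [Finset.sum_const, nsmul_eq_mul]; ring

theorem card_filter_range_cast_eq_le {q : ℕ} [NeZero q] (X : ℕ) (a : ZMod q) :
    (((Finset.range X).filter fun m : ℕ => (m : ZMod q) = a).card : ℝ) ≤ X / q + 1 := by
  have hq : 0 < q := NeZero.pos q
  have h := Nat.count_modEq_card X hq a.val
  rw [Nat.count_eq_card_filter_range] at h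
  have h' : ((Finset.range X).filter fun m : ℕ => (m : ZMod q) = a).card ≤ X / q + 1 := by
    have : ((Finset.range X).filter fun m : ℕ => (m : ZMod q) = a) =
        (Finset.range X).filter fun m => m ≡ a.val [MOD q] := by
      refine Finset.filter_congr fun m _ => ?_
      rw [← ZMod.natCast_eq_natCast_iff, ZMod.natCast_zmod_val]
    rw [this]
    convert h.le.trans _
    split_ifs <;> omega
  calc _ ≤ ((X / q + 1 : ℕ) : ℝ) := by exact_mod_cast h'
    _ ≤ _ := by push_cast; gcongr; exact Nat.cast_div_le

/-- Moments of a character sum over rough integers in a dyadic block. -/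
theorem sum_norm_pow_block_le {q M l : ℕ} [NeZero q] (hM : 0 < M) (B : Finset ℕ)
    (hB : ∀ n ∈ B, M ≤ n ∧ n < 2 * M ∧ ∀ p : ℕ, p.Prime → p ∣ n → l ^ 3 ≤ p) (hl : 0 < l)
    (c : ℕ → ℂ) (hc : ∀ n ∈ B, ‖c n‖ ≤ (M : ℝ)⁻¹) :
    ∑ χ : DirichletCharacter ℂ q, ‖∑ n ∈ B, χ (n : ZMod q) * c n‖ ^ (2 * l) ≤
      q.totient * (((2 * M : ℝ) ^ l) ^ ((1 : ℝ) / 3) * (2 ^ l / q + ((M : ℝ) ^ l)⁻¹)) := by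
  set T : Finset (Fin l → ℕ) := Fintype.piFinset fun _ : Fin l => B with hT
  have hTB : ∀ t ∈ T, ∀ i, t i ∈ B := fun t ht => Fintype.mem_piFinset.1 ht
  have hM' : (0 : ℝ) < M := by exact_mod_cast hM
  have hcard : (T.card : ℝ) ≤ (M : ℝ) ^ l := by
    have h1 : B.card ≤ M := by
      calc B.card ≤ (Finset.Ico M (2 * M)).card :=
            Finset.card_le_card fun n hn => Finset.mem_Ico.2 ⟨(hB n hn).1, (hB n hn).2.1⟩
        _ = M := by rw [Nat.card_Ico]; omega
    rw [hT, Fintype.card_piFinset]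
    simp only [Finset.prod_const, Finset.card_univ, Fintype.card_fin]
    exact_mod_cast Nat.pow_le_pow_left h1 l
  have hlt : ∀ t ∈ T, ∏ i, t i < (2 * M) ^ l := by
    intro t ht
    have : Nonempty (Fin l) := ⟨⟨0, hl⟩⟩
    have := Finset.prod_lt_prod_of_nonempty (s := (Finset.univ : Finset (Fin l))) (f := t)
      (g := fun _ => 2 * M) (fun i _ => hM.trans_le (hB _ (hTB t ht i)).1)
      (fun i _ => (hB _ (hTB t ht i)).2.1) Finset.univ_nonempty
    simpa using this
  have hfib : ∀ m ∈ Finset.range ((2 * M) ^ l),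
      ((T.filter fun t => ∏ i, t i = m).card : ℝ) ≤ ((2 * M : ℝ) ^ l) ^ ((1 : ℝ) / 3) := by
    intro m hm
    rcases (T.filter fun t => ∏ i, t i = m).eq_empty_or_nonempty with h0 | ⟨t, ht⟩
    · rw [h0]; simp only [Finset.card_empty, Nat.cast_zero]; positivity
    · obtain ⟨htT, htm⟩ := Finset.mem_filter.1 ht
      have hm0 : m ≠ 0 := by
        rw [← htm]
        exact Finset.prod_ne_zero_iff.2 fun i _ => (hM.trans_le (hB _ (hTB t htT i)).1).ne'
      have h1 : (T.filter fun t => ∏ i, t i = m).card ≤ (Nat.finMulAntidiag l m).card :=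
        Finset.card_le_card fun s hs =>
          Nat.mem_finMulAntidiag.2 ⟨(Finset.mem_filter.1 hs).2, hm0⟩
      have h2 : (Nat.finMulAntidiag l m).card ^ 3 ≤ m := by
        refine card_finMulAntidiag_pow_three_le l hm0 fun p hp hpm => ?_
        rw [← htm] at hpm
        obtain ⟨i, -, hi⟩ := (Prime.dvd_finsetProd_iff hp.prime t).1 hpm
        exact (hB _ (hTB t htT i)).2.2 p hp hi
      have h3 : ((T.filter fun t => ∏ i, t i = m).card : ℝ) ^ 3 ≤ (2 * M : ℝ) ^ l := by
        exact_mod_cast (Nat.pow_le_pow_left h1 3).trans (h2.trans (Finset.mem_range.1 hm).le)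
      calc ((T.filter fun t => ∏ i, t i = m).card : ℝ)
          = (((T.filter fun t => ∏ i, t i = m).card : ℝ) ^ 3) ^ ((1 : ℝ) / 3) := by
            rw [← Real.rpow_natCast, ← Real.rpow_mul (Nat.cast_nonneg _)]; norm_num
        _ ≤ _ := Real.rpow_le_rpow (by positivity) h3 (by norm_num)
  have hD : ∀ a : ZMod q, ((T.filter fun t => ((∏ i, t i : ℕ) : ZMod q) = a).card : ℝ) ≤
      ((2 * M : ℝ) ^ l) ^ ((1 : ℝ) / 3) * ((2 * M : ℝ) ^ l / q + 1) := by
    intro a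
    have hmaps : ∀ t ∈ T.filter fun t => ((∏ i, t i : ℕ) : ZMod q) = a,
        ∏ i, t i ∈ (Finset.range ((2 * M) ^ l)).filter fun m : ℕ => (m : ZMod q) = a := by
      intro t ht
      obtain ⟨h1, h2⟩ := Finset.mem_filter.1 ht
      exact Finset.mem_filter.2 ⟨Finset.mem_range.2 (hlt t h1), h2⟩
    rw [Finset.card_eq_sum_card_fiberwise hmaps]
    push_cast
    calc _ ≤ ∑ m ∈ (Finset.range ((2 * M) ^ l)).filter fun m : ℕ => (m : ZMod q) = a,
          ((2 * M : ℝ) ^ l) ^ ((1 : ℝ) / 3) := by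
          refine Finset.sum_le_sum fun m hm => le_trans ?_ (hfib m (Finset.mem_filter.1 hm).1)
          exact_mod_cast Finset.card_le_card
            (Finset.filter_subset_filter _ (Finset.filter_subset _ _))
      _ ≤ _ := by
          rw [Finset.sum_const, nsmul_eq_mul, mul_comm]
          gcongr
          simpa using card_filter_range_cast_eq_le (q := q) ((2 * M) ^ l) a
  have hmain := sum_norm_sq_dirichletCharacter_le (q := q) T (fun t => ∏ i, t i)
    (fun t => ∏ i, c (t i)) (A := ((M : ℝ)⁻¹) ^ l) (by positivity) (fun t ht => by
      rw [norm_prod]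
      calc _ ≤ ∏ i : Fin l, (M : ℝ)⁻¹ :=
            Finset.prod_le_prod (fun _ _ => norm_nonneg _) fun i _ => hc _ (hTB t ht i)
        _ = _ := by simp) hD
  have hpow : ∀ χ : DirichletCharacter ℂ q, ‖∑ n ∈ B, χ (n : ZMod q) * c n‖ ^ (2 * l) =
      ‖∑ t ∈ T, χ ((∏ i, t i : ℕ) : ZMod q) * ∏ i, c (t i)‖ ^ 2 := by
    intro χ
    rw [mul_comm 2 l, pow_mul, ← norm_pow, Finset.sum_pow']
    congr 2
    refine Finset.sum_congr rfl fun t _ => ?_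
    rw [Finset.prod_mul_distrib, Nat.cast_prod, map_prod]
  simp only [hpow]
  refine hmain.trans (mul_le_mul_of_nonneg_left ?_ (Nat.cast_nonneg _))
  calc (((M : ℝ)⁻¹) ^ l) ^ 2 * ((T.card : ℝ) *
        (((2 * M : ℝ) ^ l) ^ ((1 : ℝ) / 3) * ((2 * M : ℝ) ^ l / q + 1)))
      ≤ (((M : ℝ)⁻¹) ^ l) ^ 2 * ((M : ℝ) ^ l *
        (((2 * M : ℝ) ^ l) ^ ((1 : ℝ) / 3) * ((2 * M : ℝ) ^ l / q + 1))) := by gcongr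
    _ = _ := by
      have hq : (q : ℝ) ≠ 0 := NeZero.ne _
      generalize ((2 * M : ℝ) ^ l) ^ ((1 : ℝ) / 3) = R
      rw [mul_pow, inv_pow]
      field_simp

theorem norm_e2pi (x : ℝ) : ‖e2pi x‖ = 1 := by
  have : (2 * Real.pi * Complex.I * x : ℂ) = ((2 * Real.pi * x : ℝ) : ℂ) * Complex.I := by
    push_cast; ring
  rw [e2pi, this, Complex.norm_exp_ofReal_mul_I]

theorem norm_e2pi_sub_le (x y : ℝ) : ‖e2pi x - e2pi y‖ ≤ 2 * Real.pi * |x - y| := by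
  have h : e2pi x - e2pi y =
      e2pi y * (Complex.exp (Complex.I * (2 * Real.pi * (x - y) : ℝ)) - 1) := by
    rw [mul_sub, mul_one, e2pi, e2pi, ← Complex.exp_add]
    congr 2
    push_cast
    ring
  rw [h, norm_mul, norm_e2pi, one_mul]
  refine Real.norm_exp_I_mul_ofReal_sub_one_le.trans_eq ?_
  rw [Real.norm_eq_abs, abs_mul, abs_of_pos Real.two_pi_pos]

theorem SA_nonneg {q : ℕ} (χ : DirichletCharacter ℂ q) (A : Finset ℕ) : 0 ≤ SA χ A :=
  Real.iSup_nonneg fun _ => norm_nonneg _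

theorem SA_le {q : ℕ} (χ : DirichletCharacter ℂ q) (A : Finset ℕ) {b : ℝ}
    (h : ∀ α : ℝ, 0 ≤ α → α ≤ 1 → ‖∑ n ∈ A, χ (n : ZMod q) * e2pi (n * α) / n‖ ≤ b) :
    SA χ A ≤ b :=
  have : Nonempty (Set.Icc (0 : ℝ) 1) := ⟨⟨0, by simp⟩⟩
  ciSup_le fun α => h α α.2.1 α.2.2

theorem SA_pow_le {q : ℕ} (χ : DirichletCharacter ℂ q) (A : Finset ℕ) {b : ℝ} {n : ℕ} (hn : n ≠ 0)
    (hb : 0 ≤ b)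
    (h : ∀ α : ℝ, 0 ≤ α → α ≤ 1 → ‖∑ n ∈ A, χ (n : ZMod q) * e2pi (n * α) / n‖ ^ n ≤ b) :
    SA χ A ^ n ≤ b := by
  rw [← Real.rpow_inv_natCast_pow hb hn]
  refine pow_le_pow_left₀ (SA_nonneg χ A) (SA_le χ A fun α h0 h1 => ?_) n
  refine le_of_pow_le_pow_left₀ hn (by positivity) ?_
  rw [Real.rpow_inv_natCast_pow hb hn]
  exact h α h0 h1

theorem norm_term_le {q : ℕ} (χ : DirichletCharacter ℂ q) (n : ℕ) (α : ℝ) :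
    ‖χ (n : ZMod q) * e2pi (n * α) / n‖ ≤ (n : ℝ)⁻¹ := by
  rw [norm_div, norm_mul, norm_e2pi, mul_one, Complex.norm_natCast, ← one_div]
  gcongr
  exact DirichletCharacter.norm_le_one χ _

theorem norm_sum_le_SA {q : ℕ} (χ : DirichletCharacter ℂ q) (A : Finset ℕ) {α : ℝ} (h0 : 0 ≤ α)
    (h1 : α ≤ 1) : ‖∑ n ∈ A, χ (n : ZMod q) * e2pi (n * α) / n‖ ≤ SA χ A := by
  refine le_ciSup (f := fun α : Set.Icc (0 : ℝ) 1 =>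
    ‖∑ n ∈ A, χ (n : ZMod q) * e2pi (n * (α : ℝ)) / n‖) ⟨∑ n ∈ A, (n : ℝ)⁻¹, ?_⟩ ⟨α, h0, h1⟩
  rintro _ ⟨β, rfl⟩
  exact (norm_sum_le _ _).trans (Finset.sum_le_sum fun n _ => norm_term_le χ n β)

theorem SA_le_sum_fiberwise {q : ℕ} (χ : DirichletCharacter ℂ q) (A : Finset ℕ) {J : ℕ} (f : ℕ → ℕ)
    (hf : ∀ n ∈ A, f n ∈ Finset.range J) :
    SA χ A ≤ ∑ j ∈ Finset.range J, SA χ (A.filter fun n => f n = j) := by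
  refine SA_le χ A fun α h0 h1 => ?_
  rw [← Finset.sum_fiberwise_of_maps_to hf]
  exact (norm_sum_le _ _).trans (Finset.sum_le_sum fun j _ => norm_sum_le_SA χ _ h0 h1)

/-- The maximum over `α` is controlled by the values at the fractions `a / P`. -/
theorem SA_block_pow_le {q M P k l : ℕ} (χ : DirichletCharacter ℂ q) (hM : 0 < M) (hP : 0 < P)
    (B : Finset ℕ) (hB : ∀ n ∈ B, M ≤ n ∧ n < 2 * M) (hk : k ≠ 0) (hlk : l ≤ k) :
    SA χ B ^ (2 * k) ≤ 4 ^ k * (∑ a ∈ Finset.range (P + 1),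
      ‖∑ n ∈ B, χ (n : ZMod q) * e2pi (n * (a / P : ℝ)) / n‖ ^ (2 * l) +
        (2 * Real.pi * M / P) ^ (2 * k)) := by
  have hM' : (0 : ℝ) < M := by exact_mod_cast hM
  have hP' : (0 : ℝ) < P := by exact_mod_cast hP
  have hcard : (B.card : ℝ) ≤ M := by
    have : B.card ≤ (Finset.Ico M (2 * M)).card :=
      Finset.card_le_card fun n hn => Finset.mem_Ico.2 (hB n hn)
    rw [Nat.card_Ico] at this
    exact_mod_cast this.trans (by omega)
  have hone : ∀ α : ℝ, ‖∑ n ∈ B, χ (n : ZMod q) * e2pi (n * α) / n‖ ≤ 1 := by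
    intro α
    calc _ ≤ ∑ n ∈ B, (M : ℝ)⁻¹ := by
          refine (norm_sum_le _ _).trans (Finset.sum_le_sum fun n hn =>
            (norm_term_le χ n α).trans ?_)
          gcongr
          exact (hB n hn).1
      _ = B.card * (M : ℝ)⁻¹ := by rw [Finset.sum_const, nsmul_eq_mul]
      _ ≤ M * (M : ℝ)⁻¹ := by gcongr
      _ = 1 := mul_inv_cancel₀ hM'.ne'
  refine SA_pow_le χ B (by omega) (by positivity) fun α h0 h1 => ?_
  set a : ℕ := ⌊α * P⌋₊ with ha
  have haP : a ∈ Finset.range (P + 1) := by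
    rw [Finset.mem_range, Nat.lt_succ_iff]
    refine Nat.floor_le_of_le ?_
    nlinarith
  have hdist : |α - a / P| ≤ 1 / P := by
    have h2 : (a : ℝ) ≤ α * P := Nat.floor_le (by positivity)
    have h3 : α * P < a + 1 := Nat.lt_floor_add_one _
    have h4 : α - a / P = (α * P - a) / P := by field_simp
    rw [h4, abs_of_nonneg (div_nonneg (by linarith) hP'.le)]
    gcongr
    linarith
  have herr : ‖∑ n ∈ B, χ (n : ZMod q) * e2pi (n * α) / n -
      ∑ n ∈ B, χ (n : ZMod q) * e2pi (n * (a / P : ℝ)) / n‖ ≤ 2 * Real.pi * M / P := by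
    rw [← Finset.sum_sub_distrib]
    calc _ ≤ ∑ n ∈ B, 2 * Real.pi / P := by
          refine (norm_sum_le _ _).trans (Finset.sum_le_sum fun n hn => ?_)
          have hn : (0 : ℝ) < n := by exact_mod_cast hM.trans_le (hB n hn).1
          rw [← sub_div, ← mul_sub, norm_div, norm_mul, Complex.norm_natCast, div_le_iff₀ hn]
          calc _ ≤ 1 * (2 * Real.pi * |n * α - n * (a / P : ℝ)|) := by
                gcongr
                · exact DirichletCharacter.norm_le_one χ _
                · exact norm_e2pi_sub_le _ _
            _ = 2 * Real.pi * (|α - a / P| * n) := by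
                rw [← mul_sub, abs_mul, abs_of_pos hn]; ring
            _ ≤ 2 * Real.pi * (1 / P * n) := by gcongr
            _ = _ := by ring
      _ = B.card * (2 * Real.pi / P) := by rw [Finset.sum_const, nsmul_eq_mul]
      _ ≤ M * (2 * Real.pi / P) := by gcongr
      _ = _ := by ring
  set t := ‖∑ n ∈ B, χ (n : ZMod q) * e2pi (n * (a / P : ℝ)) / n‖ with ht
  calc ‖∑ n ∈ B, χ (n : ZMod q) * e2pi (n * α) / n‖ ^ (2 * k)
      ≤ (t + 2 * Real.pi * M / P) ^ (2 * k) := by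
        gcongr
        exact (norm_le_norm_add_norm_sub' _ _).trans (by gcongr)
    _ ≤ 2 ^ (2 * k - 1) * (t ^ (2 * k) + (2 * Real.pi * M / P) ^ (2 * k)) :=
        add_pow_le (norm_nonneg _) (by positivity) _
    _ ≤ 4 ^ k * (t ^ (2 * l) + (2 * Real.pi * M / P) ^ (2 * k)) := by
        have h4 : (4 : ℝ) ^ k = 2 ^ (2 * k) := by rw [pow_mul]; norm_num
        rw [h4]
        gcongr ?_ * (?_ + _)
        · exact pow_le_pow_right₀ one_le_two (by omega)
        · exact pow_le_pow_of_le_one (norm_nonneg _) (hone _) (by omega)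
    _ ≤ _ := by
        gcongr
        exact Finset.single_le_sum (f := fun a : ℕ =>
          ‖∑ n ∈ B, χ (n : ZMod q) * e2pi (n * (a / P : ℝ)) / n‖ ^ (2 * l))
          (fun _ _ => by positivity) haP

theorem sum_SA_block_pow_le {q M P k l : ℕ} [NeZero q] (hM : 0 < M) (hP : 0 < P)
    (B : Finset ℕ) (hB : ∀ n ∈ B, M ≤ n ∧ n < 2 * M ∧ ∀ p : ℕ, p.Prime → p ∣ n → k ^ 3 ≤ p)
    (hl : 0 < l) (hlk : l ≤ k) :
    ∑ χ : DirichletCharacter ℂ q, SA χ B ^ (2 * k) ≤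
      q.totient * (4 ^ k * ((P + 1) * (((2 * M : ℝ) ^ l) ^ ((1 : ℝ) / 3) *
        (2 ^ l / q + ((M : ℝ) ^ l)⁻¹)) + (2 * Real.pi * M / P) ^ (2 * k))) := by
  have hcardχ : ((Finset.univ : Finset (DirichletCharacter ℂ q)).card : ℝ) = q.totient := by
    rw [Finset.card_univ, ← Nat.card_eq_fintype_card]
    exact_mod_cast DirichletCharacter.card_eq_totient_of_hasEnoughRootsOfUnity ℂ q
  calc _ ≤ ∑ χ : DirichletCharacter ℂ q, 4 ^ k * (∑ a ∈ Finset.range (P + 1),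
      ‖∑ n ∈ B, χ (n : ZMod q) * e2pi (n * (a / P : ℝ)) / n‖ ^ (2 * l) +
        (2 * Real.pi * M / P) ^ (2 * k)) := Finset.sum_le_sum fun χ _ =>
        SA_block_pow_le χ hM hP B (fun n hn => ⟨(hB n hn).1, (hB n hn).2.1⟩) (by omega) hlk
    _ = 4 ^ k * (∑ a ∈ Finset.range (P + 1), ∑ χ : DirichletCharacter ℂ q,
      ‖∑ n ∈ B, χ (n : ZMod q) * (e2pi (n * (a / P : ℝ)) / n)‖ ^ (2 * l) +
        q.totient * (2 * Real.pi * M / P) ^ (2 * k)) := by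
        rw [← Finset.mul_sum, Finset.sum_add_distrib, Finset.sum_comm, Finset.sum_const,
          nsmul_eq_mul, hcardχ]
        simp only [mul_div_assoc]
    _ ≤ 4 ^ k * (∑ a ∈ Finset.range (P + 1), q.totient * (((2 * M : ℝ) ^ l) ^ ((1 : ℝ) / 3) *
        (2 ^ l / q + ((M : ℝ) ^ l)⁻¹)) + q.totient * (2 * Real.pi * M / P) ^ (2 * k)) := by
        gcongr with a _
        refine sum_norm_pow_block_le hM B (fun n hn => ⟨(hB n hn).1, (hB n hn).2.1,
          fun p hp hpn => (Nat.pow_le_pow_left hlk 3).trans ((hB n hn).2.2 p hp hpn)⟩) hl _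
          fun n hn => ?_
        rw [norm_div, norm_e2pi, Complex.norm_natCast, one_div]
        gcongr
        exact (hB n hn).1
    _ = _ := by
        rw [Finset.sum_const, nsmul_eq_mul, Finset.card_range]
        push_cast
        ring

/-- For every admissible size `M` some moment `l ≤ k` balances diagonal and off-diagonal terms. -/
theorem exists_moment_exponent {L m : ℝ} {k : ℕ} (hm : 0 < m) (hmL : m ≤ 11 / 21 * L) (hk : 3 ≤ k) :
    ∃ l : ℕ, 0 < l ∧ l ≤ k ∧ (41 / 40 + l / 3) * m - L ≤ -(113 / 1000) * L ∧
      ((41 / 40 - 2 * l / 3) * m ≤ -(113 / 1000) * L ∨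
        (41 / 40 - 2 * l / 3) * m ≤ -(k / 20) * m) := by
  have hk' : (3 : ℝ) ≤ k := by exact_mod_cast hk
  have hL : 0 < L := by linarith
  rcases le_or_gt (k * m) L with h | h
  · exact ⟨k, by omega, le_rfl, by nlinarith, Or.inr (by nlinarith)⟩
  rcases le_or_gt m (2 / 5 * L) with h2 | h2
  · have h3 : L ≤ ⌈L / m⌉₊ * m := by
      rw [← div_le_iff₀ hm]; exact Nat.le_ceil _
    have h4 : ⌈L / m⌉₊ * m ≤ L + m := by
      have := (Nat.ceil_lt_add_one (div_pos hL hm).le).le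
      calc _ ≤ (L / m + 1) * m := by gcongr
        _ = L + m := by field_simp
    refine ⟨⌈L / m⌉₊, Nat.ceil_pos.2 (div_pos hL hm), Nat.ceil_le.2 ?_, by nlinarith,
      Or.inl (by nlinarith)⟩
    rw [div_le_iff₀ hm]; exact h.le
  · exact ⟨2, by norm_num, by omega, by push_cast; nlinarith, Or.inl (by push_cast; nlinarith)⟩

theorem sum_SA_block_pow_le_rpow {q M k : ℕ} (hM : 1 < M)
    (hMq : (M : ℝ) ≤ (q : ℝ) ^ ((11 : ℝ) / 21)) (hk : 3 ≤ k) (B : Finset ℕ)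
    (hB : ∀ n ∈ B, M ≤ n ∧ n < 2 * M ∧ ∀ p : ℕ, p.Prime → p ∣ n → k ^ 3 ≤ p) :
    ∑ χ : DirichletCharacter ℂ q, SA χ B ^ (2 * k) ≤
      q.totient * (400 ^ k * ((q : ℝ) ^ (-(113 : ℝ) / 1000) + (M : ℝ) ^ (-(k : ℝ) / 20))) := by
  have hM' : (1 : ℝ) < M := by exact_mod_cast hM
  have hM0 : (0 : ℝ) < M := by linarith
  have hq : q ≠ 0 := by
    rintro rfl
    rw [Nat.cast_zero, Real.zero_rpow (by norm_num)] at hMq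
    linarith
  have : NeZero q := ⟨hq⟩
  have hq0 : (0 : ℝ) < q := by positivity
  have hlog : Real.log M ≤ 11 / 21 * Real.log q := by
    rw [← Real.log_rpow hq0]; exact Real.log_le_log hM0 hMq
  obtain ⟨l, hl, hlk, hfirst, hsecond⟩ := exists_moment_exponent (Real.log_pos hM') hlog hk
  set P := ⌈(M : ℝ) ^ ((41 : ℝ) / 40)⌉₊ with hP
  set X := (M : ℝ) ^ ((41 : ℝ) / 40) with hX
  have hX1 : 1 ≤ X := Real.one_le_rpow hM'.le (by norm_num)
  have hPX : X ≤ P := Nat.le_ceil _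
  have hPX' : (P : ℝ) + 1 ≤ 3 * X := by
    have := Nat.ceil_lt_add_one (a := X) (by linarith)
    linarith
  have hP0 : 0 < P := Nat.ceil_pos.2 (by linarith)
  have hP0' : (0 : ℝ) < P := by exact_mod_cast hP0
  refine (sum_SA_block_pow_le (q := q) (by omega : 0 < M) hP0 B hB hl hlk).trans
    (mul_le_mul_of_nonneg_left ?_ (Nat.cast_nonneg _))
  set Q := (q : ℝ) ^ (-(113 : ℝ) / 1000) with hQ
  set Y := (M : ℝ) ^ (-(k : ℝ) / 20) with hY
  have hQ0 : 0 ≤ Q := by positivity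
  have hY0 : 0 ≤ Y := by positivity
  have herr : (2 * Real.pi * M / P) ^ (2 * k) ≤ 49 ^ k * Y := by
    have h1 : 2 * Real.pi * M / P ≤ 7 * (M : ℝ) ^ (-(1 : ℝ) / 40) := by
      rw [div_le_iff₀ hP0']
      have h2 : (M : ℝ) ^ (-(1 : ℝ) / 40) * X = M := by
        rw [hX, ← Real.rpow_add hM0]; norm_num
      calc 2 * Real.pi * M ≤ 7 * M := by
            gcongr; linarith [Real.pi_lt_d2]
        _ = 7 * (M : ℝ) ^ (-(1 : ℝ) / 40) * X := by rw [mul_assoc, h2]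
        _ ≤ _ := by gcongr
    calc _ ≤ (7 * (M : ℝ) ^ (-(1 : ℝ) / 40)) ^ (2 * k) := by gcongr
      _ = 49 ^ k * Y := by
        rw [mul_pow, pow_mul, ← Real.rpow_natCast ((M : ℝ) ^ (-(1 : ℝ) / 40)),
          ← Real.rpow_mul hM0.le, hY]
        norm_num
        congr 1
        ring
  have hcube : ((2 * M : ℝ) ^ l) ^ ((1 : ℝ) / 3) ≤ 2 ^ l * (M : ℝ) ^ ((l : ℝ) / 3) := by
    rw [mul_pow, Real.mul_rpow (by positivity) (by positivity), ← Real.rpow_natCast (M : ℝ) l,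
      ← Real.rpow_mul hM0.le, mul_one_div]
    gcongr
    exact Real.rpow_le_self_of_one_le (one_le_pow₀ one_le_two) (by norm_num)
  have hoff : X * (M : ℝ) ^ ((l : ℝ) / 3) / q ≤ Q := by
    rw [hX, ← Real.rpow_add hM0, Real.rpow_def_of_pos hM0, hQ, Real.rpow_def_of_pos hq0]
    nth_rewrite 1 [← Real.exp_log hq0]
    rw [← Real.exp_sub]
    exact Real.exp_le_exp.2 (by linarith)
  have hdiag : X * (M : ℝ) ^ ((l : ℝ) / 3) * ((M : ℝ) ^ l)⁻¹ ≤ Q + Y := by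
    rw [hX, ← Real.rpow_natCast (M : ℝ) l, ← Real.rpow_neg hM0.le, ← Real.rpow_add hM0,
      ← Real.rpow_add hM0]
    rcases hsecond with h | h
    · refine le_trans ?_ (le_add_of_nonneg_right hY0)
      rw [Real.rpow_def_of_pos hM0, hQ, Real.rpow_def_of_pos hq0]
      exact Real.exp_le_exp.2 (by linarith)
    · refine le_trans ?_ (le_add_of_nonneg_left hQ0)
      rw [Real.rpow_def_of_pos hM0, hY, Real.rpow_def_of_pos hM0]
      exact Real.exp_le_exp.2 (by linarith)
  have hmain : ((P : ℝ) + 1) * (((2 * M : ℝ) ^ l) ^ ((1 : ℝ) / 3) *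
      (2 ^ l / q + ((M : ℝ) ^ l)⁻¹)) ≤ 3 * 4 ^ k * (2 * Q + Y) := by
    calc _ ≤ 3 * X * (2 ^ l * (M : ℝ) ^ ((l : ℝ) / 3) *
          (2 ^ l / q + 2 ^ l * ((M : ℝ) ^ l)⁻¹)) := by
          gcongr
          exact le_mul_of_one_le_left (by positivity) (one_le_pow₀ one_le_two)
      _ = 3 * (2 ^ l * 2 ^ l) * (X * (M : ℝ) ^ ((l : ℝ) / 3) / q +
          X * (M : ℝ) ^ ((l : ℝ) / 3) * ((M : ℝ) ^ l)⁻¹) := by ring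
      _ ≤ 3 * (2 ^ k * 2 ^ k) * (Q + (Q + Y)) := by
          gcongr <;> norm_num
      _ = _ := by rw [← mul_pow]; norm_num; ring
  have h6 : (6 : ℝ) ≤ 6 ^ k := le_self_pow₀ (by norm_num) (by omega)
  have h2 : (2 : ℝ) ≤ 2 ^ k := le_self_pow₀ (by norm_num) (by omega)
  have h96 : (6 : ℝ) * 16 ^ k ≤ 200 ^ k := by
    calc (6 : ℝ) * 16 ^ k ≤ 6 ^ k * 16 ^ k := by gcongr
      _ = 96 ^ k := by rw [← mul_pow]; norm_num
      _ ≤ 200 ^ k := by gcongr; norm_num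
  have h196 : (196 : ℝ) ^ k ≤ 200 ^ k := by gcongr; norm_num
  have h400 : (2 : ℝ) * 200 ^ k ≤ 400 ^ k := by
    calc (2 : ℝ) * 200 ^ k ≤ 2 ^ k * 200 ^ k := by gcongr
      _ = 400 ^ k := by rw [← mul_pow]; norm_num
  calc _ ≤ 4 ^ k * (3 * 4 ^ k * (2 * Q + Y) + 49 ^ k * Y) := by gcongr
    _ = (6 * 16 ^ k) * Q + (3 * 16 ^ k + 196 ^ k) * Y := by
        rw [show (16 : ℝ) = 4 * 4 by norm_num, show (196 : ℝ) = 4 * 49 by norm_num, mul_pow,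
          mul_pow]; ring
    _ ≤ 400 ^ k * Q + 400 ^ k * Y := by
        gcongr
        · nlinarith [pow_pos (show (0 : ℝ) < 200 by norm_num) k]
        · nlinarith [pow_pos (show (0 : ℝ) < 16 by norm_num) k]
    _ = _ := by ring

/-- Factors exponential in `k` are absorbed by small powers of `y ^ k` once `k ^ 3 ≤ y`. -/
theorem exists_pow_le_mul_rpow {K ε : ℝ} (hK : 1 ≤ K) (hε : 0 < ε) :
    ∃ C : ℝ, 0 < C ∧ ∀ (k : ℕ) (y : ℝ), 1 ≤ k → (k : ℝ) ^ 3 ≤ y → K ^ k ≤ C * y ^ (ε * k) := by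
  have hK0 : 0 < K := by linarith
  refine ⟨K ^ (K ^ ε⁻¹), by positivity, fun k y hk hy => ?_⟩
  have hk1 : (1 : ℝ) ≤ k := by exact_mod_cast hk
  have hky : (k : ℝ) ≤ y := (le_self_pow₀ hk1 (by norm_num)).trans hy
  have hC : 1 ≤ K ^ (K ^ ε⁻¹) := Real.one_le_rpow hK (by positivity)
  rcases le_total (K ^ ε⁻¹) y with h | h
  · have h1 : K ≤ y ^ ε := by
      calc K = (K ^ ε⁻¹) ^ ε := by
            rw [← Real.rpow_mul hK0.le, inv_mul_cancel₀ hε.ne', Real.rpow_one]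
        _ ≤ y ^ ε := Real.rpow_le_rpow (by positivity) h hε.le
    calc K ^ k ≤ (y ^ ε) ^ k := by gcongr
      _ = y ^ (ε * k) := by rw [← Real.rpow_natCast, ← Real.rpow_mul (by linarith)]
      _ ≤ _ := le_mul_of_one_le_left (Real.rpow_nonneg (by linarith) _) hC
  · calc K ^ k = K ^ (k : ℝ) := (Real.rpow_natCast _ _).symm
      _ ≤ K ^ (K ^ ε⁻¹) := Real.rpow_le_rpow_of_exponent_le hK (hky.trans h)
      _ ≤ _ := le_mul_of_one_le_right (by positivity)
          (Real.one_le_rpow (hk1.trans hky) (by positivity))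

theorem le_log_of_le_div_loglog {q k : ℕ} (hk : 3 ≤ k)
    (h : (k : ℝ) ≤ Real.log q / (400 * Real.log (Real.log q))) :
    2400 ≤ Real.log q ∧ k * Real.log (Real.log q) ≤ Real.log q / 400 := by
  have hk' : (3 : ℝ) ≤ k := by exact_mod_cast hk
  set L := Real.log q with hL
  have hL0 : 0 ≤ L := Real.log_natCast_nonneg q
  have hpos : 0 < Real.log L := by
    by_contra! hneg
    have : L / (400 * Real.log L) ≤ 0 := div_nonpos_of_nonneg_of_nonpos hL0 (by linarith)
    linarith
  have hmul : k * Real.log L ≤ L / 400 := by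
    rw [le_div_iff₀ (by positivity)] at h
    linarith
  refine ⟨?_, hmul⟩
  have h1200 : 1200 * Real.log L ≤ L := by nlinarith
  have hL1 : 1 < L := by
    by_contra! h1
    exact absurd (Real.log_nonpos hL0 h1) (not_le.2 hpos)
  have hq3 : 3 ≤ q := by
    by_contra! hq
    have hq2 : (q : ℝ) ≤ 2 := by exact_mod_cast (by omega : q ≤ 2)
    have : L ≤ 1 := by
      rcases Nat.eq_zero_or_pos q with h0 | h0
      · rw [hL, h0]; simp
      · have : Real.log q ≤ q - 1 := Real.log_le_sub_one_of_pos (by exact_mod_cast h0)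
        linarith
    linarith
  have hLlow : 1.09 ≤ L := by
    have h3 : Real.log 3 ≤ L := Real.log_le_log (by norm_num) (by exact_mod_cast hq3)
    have h4 := Real.one_sub_inv_le_log_of_pos (x := 3 / Real.exp 1) (by positivity)
    rw [Real.log_div (by norm_num) (Real.exp_ne_zero _), Real.log_exp, inv_div] at h4
    have := Real.exp_one_lt_d9
    norm_num at *
    linarith
  have hLmid : 1000 ≤ L := by
    have h4 := Real.one_sub_inv_le_log_of_pos (x := L) (by linarith)
    have h5 : L⁻¹ * L = 1 := inv_mul_cancel₀ (by linarith)
    by_contra! h6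
    norm_num at *
    nlinarith
  have h2 : 2 ≤ Real.log L := by
    rw [Real.le_log_iff_exp_le (by linarith)]
    calc Real.exp 2 = Real.exp 1 ^ 2 := by rw [← Real.exp_nat_mul]; norm_num
      _ ≤ 3 ^ 2 := by gcongr; exact Real.exp_one_lt_three.le
      _ ≤ L := by linarith
  linarith

theorem log_pow_le_rpow {q k : ℕ} (hk : 3 ≤ k)
    (h : (k : ℝ) ≤ Real.log q / (400 * Real.log (Real.log q))) (n : ℕ) :
    Real.log q ^ (n * k) ≤ (q : ℝ) ^ ((n : ℝ) / 400) := by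
  obtain ⟨h1, h2⟩ := le_log_of_le_div_loglog hk h
  have hL : 0 < Real.log q := by linarith
  have hq : (0 : ℝ) < q := by
    refine Nat.cast_pos.2 (Nat.pos_of_ne_zero ?_)
    rintro rfl
    simp at hL
  rw [← Real.rpow_natCast, Real.rpow_def_of_pos hL, Real.rpow_def_of_pos hq, Real.exp_le_exp]
  push_cast
  nlinarith [mul_le_mul_of_nonneg_left h2 (Nat.cast_nonneg (α := ℝ) n)]

/-- Weights that decay geometrically but stay above `1 / (2 * J)`. -/
theorem exists_weights {J : ℕ} (hJ : 0 < J) {ρ : ℝ} (h0 : 0 < ρ) (h1 : ρ < 1) :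
    ∃ a : ℕ → ℝ, (∀ j, 0 < a j) ∧ ∑ j ∈ Finset.range J, a j ≤ 1 ∧ (∀ j, (a j)⁻¹ ≤ 2 * J) ∧
      ∀ j, (a j)⁻¹ ≤ 2 / (1 - ρ) * (ρ ^ j)⁻¹ := by
  have hJ' : (0 : ℝ) < J := by exact_mod_cast hJ
  have h1' : 0 < 1 - ρ := by linarith
  refine ⟨fun j => (1 / J + (1 - ρ) * ρ ^ j) / 2, fun j => by positivity, ?_, fun j => ?_,
    fun j => ?_⟩
  · rw [← Finset.sum_div, Finset.sum_add_distrib, ← Finset.mul_sum, mul_neg_geom_sum,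
      Finset.sum_const, Finset.card_range, nsmul_eq_mul, mul_one_div_cancel hJ'.ne']
    have : 0 < ρ ^ J := by positivity
    linarith
  · rw [inv_le_comm₀ (by positivity) (by positivity), mul_inv]
    have : 0 < (1 - ρ) * ρ ^ j := by positivity
    rw [one_div]
    linarith
  · rw [inv_le_comm₀ (by positivity) (by positivity), mul_inv, inv_inv, inv_div]
    have : 0 < 1 / (J : ℝ) := by positivity
    linarith

theorem pow_le_sum_inv_weight_mul_pow {J n : ℕ} {a S : ℕ → ℝ} {x : ℝ} (hx : 0 ≤ x)
    (ha : ∀ j, 0 < a j) (hS : ∀ j, 0 ≤ S j) (hsum : ∑ j ∈ Finset.range J, a j ≤ 1)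
    (hJ : 0 < J) (hxS : x ≤ ∑ j ∈ Finset.range J, S j) :
    x ^ n ≤ ∑ j ∈ Finset.range J, (a j)⁻¹ ^ n * S j ^ n := by
  obtain ⟨j, hj, hle⟩ : ∃ j ∈ Finset.range J, a j * x ≤ S j := by
    refine Finset.exists_le_of_sum_le (Finset.nonempty_range_iff.2 hJ.ne') ?_
    rw [← Finset.sum_mul]
    nlinarith
  have hxj : x ≤ (a j)⁻¹ * S j := by
    rw [inv_mul_eq_div, le_div_iff₀ (ha j), mul_comm]; exact hle
  calc x ^ n ≤ ((a j)⁻¹ * S j) ^ n := by gcongr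
    _ = (a j)⁻¹ ^ n * S j ^ n := mul_pow _ _ _
    _ ≤ _ := Finset.single_le_sum (f := fun j => (a j)⁻¹ ^ n * S j ^ n)
        (fun j _ => mul_nonneg (pow_nonneg (inv_nonneg.2 (ha j).le) _) (pow_nonneg (hS j) _)) hj

theorem geom_sum_le_inv_one_sub {ρ : ℝ} (h0 : 0 < ρ) (h1 : ρ < 1) (J : ℕ) :
    ∑ j ∈ Finset.range J, ρ ^ j ≤ (1 - ρ)⁻¹ := by
  rw [← tsum_geometric_of_lt_one h0.le h1]
  exact (summable_geometric_of_lt_one h0.le h1).sum_le_tsum _ fun _ _ => by positivity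

/-- The contribution of the dyadic blocks with the geometric weights. -/
theorem sum_weighted_block_le {y ρ b : ℝ} (hρ : ρ = 2 ^ (-(1 : ℝ) / 80)) (hy : 0 < y) {k : ℕ}
    (hk : 1 ≤ k) (J : ℕ) (a M : ℕ → ℝ) (hM : ∀ j, y * 2 ^ j / 2 ≤ M j) (ha : ∀ j, 0 < a j)
    (hb : 0 ≤ b) (hab : ∀ j, (a j)⁻¹ ≤ b * (ρ ^ j)⁻¹) :
    ∑ j ∈ Finset.range J, (a j)⁻¹ ^ (2 * k) * (400 ^ k * M j ^ (-(k : ℝ) / 20)) ≤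
      (1 - ρ)⁻¹ * ((800 * b ^ 2) ^ k * y ^ (-(k : ℝ) / 20)) := by
  have hρ0 : 0 < ρ := by rw [hρ]; positivity
  have hρ1 : ρ < 1 := by
    rw [hρ]; exact Real.rpow_lt_one_of_one_lt_of_neg one_lt_two (by norm_num)
  have hterm : ∀ j, (a j)⁻¹ ^ (2 * k) * (400 ^ k * M j ^ (-(k : ℝ) / 20)) ≤
      ((800 * b ^ 2) ^ k * y ^ (-(k : ℝ) / 20)) * ρ ^ j := by
    intro j
    have h1 : M j ^ (-(k : ℝ) / 20) ≤ 2 ^ k * (y ^ (-(k : ℝ) / 20) * ρ ^ (4 * k * j)) := by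
      have hneg : -(k : ℝ) / 20 ≤ 0 :=
        div_nonpos_of_nonpos_of_nonneg (neg_nonpos.2 (Nat.cast_nonneg k)) (by norm_num)
      have h2 : ((2 : ℝ) ^ j) ^ (-(k : ℝ) / 20) = ρ ^ (4 * k * j) := by
        rw [hρ, ← Real.rpow_natCast, ← Real.rpow_natCast, ← Real.rpow_mul (by norm_num),
          ← Real.rpow_mul (by norm_num)]
        congr 1
        push_cast
        ring
      have h3 : ((2 : ℝ) ^ (-(k : ℝ) / 20))⁻¹ ≤ 2 ^ k := by
        rw [← Real.rpow_neg (by norm_num), ← Real.rpow_natCast]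
        refine Real.rpow_le_rpow_of_exponent_le one_le_two ?_
        have : (0 : ℝ) ≤ k := Nat.cast_nonneg k
        linarith
      calc M j ^ (-(k : ℝ) / 20) ≤ (y * 2 ^ j / 2) ^ (-(k : ℝ) / 20) :=
            Real.rpow_le_rpow_of_nonpos (by positivity) (hM j) hneg
        _ = ((2 : ℝ) ^ (-(k : ℝ) / 20))⁻¹ * (y ^ (-(k : ℝ) / 20) * ρ ^ (4 * k * j)) := by
            rw [Real.div_rpow (by positivity) (by norm_num), Real.mul_rpow hy.le (by positivity),
              h2, div_eq_inv_mul]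
        _ ≤ _ := by gcongr
    have hinv : 0 ≤ (a j)⁻¹ := inv_nonneg.2 (ha j).le
    calc _ ≤ (b * (ρ ^ j)⁻¹) ^ (2 * k) *
          (400 ^ k * (2 ^ k * (y ^ (-(k : ℝ) / 20) * ρ ^ (4 * k * j)))) := by
          have hMj : 0 ≤ M j := le_trans (by positivity) (hM j)
          gcongr
          exact hab j
      _ = ((800 * b ^ 2) ^ k * y ^ (-(k : ℝ) / 20)) * ρ ^ (2 * k * j) := by
          have h4 : ρ ^ (4 * k * j) = (ρ ^ j) ^ (2 * k) * ρ ^ (2 * k * j) := by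
            rw [← pow_mul, ← pow_add]; congr 1; ring
          have h5 : ((ρ ^ j)⁻¹) ^ (2 * k) * (ρ ^ j) ^ (2 * k) = 1 := by
            rw [← mul_pow, inv_mul_cancel₀ (by positivity), one_pow]
          rw [h4, mul_pow, mul_pow 800, show (800 : ℝ) = 400 * 2 by norm_num, mul_pow 400,
            ← pow_mul b 2 k]
          linear_combination (b ^ (2 * k) * 400 ^ k * 2 ^ k * y ^ (-(k : ℝ) / 20) *
            ρ ^ (2 * k * j)) * h5
      _ ≤ _ := by
          refine mul_le_mul_of_nonneg_left ?_ (by positivity)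
          exact pow_le_pow_of_le_one hρ0.le hρ1.le (Nat.le_mul_of_pos_left j (by omega))
  calc _ ≤ ∑ j ∈ Finset.range J, ((800 * b ^ 2) ^ k * y ^ (-(k : ℝ) / 20)) * ρ ^ j :=
        Finset.sum_le_sum fun j _ => hterm j
    _ = (∑ j ∈ Finset.range J, ρ ^ j) * ((800 * b ^ 2) ^ k * y ^ (-(k : ℝ) / 20)) := by
        rw [← Finset.mul_sum, mul_comm]
    _ ≤ _ := by
        gcongr
        exact geom_sum_le_inv_one_sub hρ0 hρ1 J

/-- The contribution of the off-diagonal terms with the uniform weights. -/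
theorem sum_weighted_offDiag_le {q k J : ℕ} (hk : 3 ≤ k)
    (hkq : (k : ℝ) ≤ Real.log q / (400 * Real.log (Real.log q))) (hJ : (J : ℝ) ≤ Real.log q)
    (a : ℕ → ℝ) (ha : ∀ j, 0 < a j) (haJ : ∀ j, (a j)⁻¹ ≤ 2 * J) :
    ∑ j ∈ Finset.range J, (a j)⁻¹ ^ (2 * k) * (400 ^ k * (q : ℝ) ^ (-(113 : ℝ) / 1000)) ≤
      (q : ℝ) ^ (-(1 : ℝ) / 10) := by
  obtain ⟨hL, -⟩ := le_log_of_le_div_loglog hk hkq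
  have hq1 : (1 : ℝ) ≤ q := by
    refine Nat.one_le_cast.2 (Nat.pos_of_ne_zero ?_)
    rintro rfl
    norm_num at hL
  have hq : (0 : ℝ) < q := by linarith
  set L := Real.log q with hLdef
  set Q := (q : ℝ) ^ (-(113 : ℝ) / 1000) with hQ
  calc _ ≤ ∑ j ∈ Finset.range J, (2 * L) ^ (2 * k) * (400 ^ k * Q) := by
        refine Finset.sum_le_sum fun j _ => ?_
        have hinv : 0 ≤ (a j)⁻¹ := inv_nonneg.2 (ha j).le
        gcongr
        exact (haJ j).trans (by gcongr)
    _ = J * (1600 ^ k * L ^ (2 * k) * Q) := by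
        rw [Finset.sum_const, Finset.card_range, nsmul_eq_mul, mul_pow, pow_mul 2 2 k,
          show (1600 : ℝ) = 2 ^ 2 * 400 by norm_num, mul_pow]
        ring
    _ ≤ L ^ k * (L ^ k * L ^ (2 * k) * Q) := by
        gcongr
        · exact hJ.trans (le_self_pow₀ (by linarith) (by omega))
        · linarith
    _ = L ^ (4 * k) * Q := by ring
    _ ≤ (q : ℝ) ^ ((4 : ℕ) / 400 : ℝ) * Q := by
        gcongr
        exact log_pow_le_rpow hk hkq 4
    _ ≤ _ := by
        rw [hQ, ← Real.rpow_add hq]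
        exact Real.rpow_le_rpow_of_exponent_le hq1 (by norm_num)

/-- Dyadic decomposition of the moment, before absorbing the factors exponential in `k`. -/
theorem exists_moment_le_pow_mul_rpow :
    ∃ K D : ℝ, 1 ≤ K ∧ 0 < D ∧
      ∀ q k : ℕ, 3 ≤ k → (k : ℝ) ≤ Real.log q / (400 * Real.log (Real.log q)) →
        ∀ y z : ℝ, (k : ℝ) ^ 3 ≤ y → y ≤ z → z ≤ (q : ℝ) ^ ((11 : ℝ) / 21) →
          ∀ 𝒜 : Finset ℕ,
            (∀ n ∈ 𝒜, y < (n : ℝ) ∧ (n : ℝ) ≤ z ∧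
              ∀ p : ℕ, p.Prime → p ∣ n → y < (p : ℝ)) →
            (∑ χ : DirichletCharacter ℂ q, SA χ 𝒜 ^ (2 * k)) / q.totient ≤
                D * (K ^ k * y ^ (-(k : ℝ) / 20)) + (q : ℝ) ^ (-(1 : ℝ) / 10) := by
  set ρ : ℝ := 2 ^ (-(1 : ℝ) / 80) with hρ
  have hρ0 : 0 < ρ := by positivity
  have hρ1 : ρ < 1 := Real.rpow_lt_one_of_one_lt_of_neg one_lt_two (by norm_num)
  have hρ1' : 0 < 1 - ρ := by linarith
  have hb1 : 1 ≤ 2 / (1 - ρ) := by rw [le_div_iff₀ hρ1']; linarith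
  refine ⟨800 * (2 / (1 - ρ)) ^ 2, (1 - ρ)⁻¹, by nlinarith, by positivity, ?_⟩
  intro q k hk hkq y z hky hyz hzq 𝒜 h𝒜
  obtain ⟨hL, -⟩ := le_log_of_le_div_loglog hk hkq
  have hk' : (3 : ℝ) ≤ k := by exact_mod_cast hk
  have hy27 : 27 ≤ y := by
    calc (27 : ℝ) = 3 ^ 3 := by norm_num
      _ ≤ (k : ℝ) ^ 3 := by gcongr
      _ ≤ y := hky
  have hq0 : 0 < q := by
    refine Nat.pos_of_ne_zero ?_
    rintro rfl
    norm_num at hL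
  have hq0' : (0 : ℝ) < q := by exact_mod_cast hq0
  have hφ : (0 : ℝ) < q.totient := by exact_mod_cast Nat.totient_pos.2 hq0
  set i₀ := Nat.log 2 ⌊y⌋₊ with hi₀
  set i₁ := Nat.log 2 ⌊z⌋₊ with hi₁
  have hi : i₀ ≤ i₁ := Nat.log_mono_right (Nat.floor_mono hyz)
  set J := i₁ + 1 - i₀ with hJ
  have hJ0 : 0 < J := by omega
  have hfloor_z : ⌊z⌋₊ ≠ 0 := (Nat.floor_pos.2 (by linarith)).ne'
  have hpow_z : (2 : ℝ) ^ i₁ ≤ z := by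
    have h1 : 2 ^ i₁ ≤ ⌊z⌋₊ := Nat.pow_log_le_self 2 hfloor_z
    calc (2 : ℝ) ^ i₁ ≤ ⌊z⌋₊ := by exact_mod_cast h1
      _ ≤ z := Nat.floor_le (by linarith)
  have hpow_y : y / 2 ≤ (2 : ℝ) ^ i₀ := by
    have h1 : ⌊y⌋₊ + 1 ≤ 2 ^ (i₀ + 1) := Nat.lt_pow_succ_log_self one_lt_two _
    have h2 : ((⌊y⌋₊ : ℝ) + 1) ≤ 2 ^ (i₀ + 1) := by exact_mod_cast h1
    have h3 := Nat.lt_floor_add_one y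
    rw [pow_succ] at h2
    linarith
  have hJL : (J : ℝ) ≤ Real.log q := by
    have h1 : (J : ℝ) ≤ i₁ + 1 := by exact_mod_cast (by omega : J ≤ i₁ + 1)
    have h2 : i₁ * Real.log 2 ≤ 11 / 21 * Real.log q := by
      rw [← Real.log_pow, ← Real.log_rpow hq0']
      exact Real.log_le_log (by positivity) (hpow_z.trans hzq)
    have h3 := Real.log_two_gt_d9
    have h4 : (i₁ : ℝ) * 0.69 ≤ i₁ * Real.log 2 := by gcongr; linarith
    norm_num at h4
    linarith
  obtain ⟨a, ha, hsum, haJ, haρ⟩ := exists_weights hJ0 hρ0 hρ1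
  have hmap : ∀ n ∈ 𝒜, Nat.log 2 n - i₀ ∈ Finset.range J := by
    intro n hn
    have h1 : Nat.log 2 n ≤ i₁ := Nat.log_mono_right (Nat.le_floor (h𝒜 n hn).2.1)
    rw [Finset.mem_range]
    omega
  have hblock : ∀ j ∈ Finset.range J,
      ∑ χ : DirichletCharacter ℂ q, SA χ (𝒜.filter fun n => Nat.log 2 n - i₀ = j) ^ (2 * k) ≤
        q.totient * (400 ^ k * ((q : ℝ) ^ (-(113 : ℝ) / 1000) +
          ((2 : ℝ) ^ (i₀ + j)) ^ (-(k : ℝ) / 20))) := by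
    intro j hj
    have hj' : i₀ + j ≤ i₁ := by have := Finset.mem_range.1 hj; omega
    have hone : 1 < 2 ^ (i₀ + j) := by
      have h1 : (1 : ℝ) < 2 ^ i₀ := by linarith
      have h2 : 1 < 2 ^ i₀ := by exact_mod_cast h1
      exact h2.trans_le (Nat.pow_le_pow_right two_pos (by omega))
    have hle : ((2 ^ (i₀ + j) : ℕ) : ℝ) ≤ (q : ℝ) ^ ((11 : ℝ) / 21) := by
      push_cast
      exact ((pow_le_pow_right₀ one_le_two hj').trans hpow_z).trans hzq
    have := sum_SA_block_pow_le_rpow hone hle hk (𝒜.filter fun n => Nat.log 2 n - i₀ = j)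
      fun n hn => ?_
    · simpa using this
    · obtain ⟨hnA, hnj⟩ := Finset.mem_filter.1 hn
      obtain ⟨hyn, hnz, hrough⟩ := h𝒜 n hnA
      have hn0 : n ≠ 0 := by
        rintro rfl
        norm_num at hyn
        linarith
      have h1 : i₀ ≤ Nat.log 2 n :=
        Nat.log_mono_right (Nat.floor_le_of_le hyn.le)
      have h2 : Nat.log 2 n = i₀ + j := by omega
      refine ⟨h2 ▸ Nat.pow_log_le_self 2 hn0, ?_, fun p hp hpn => ?_⟩
      · have h3 := Nat.lt_pow_succ_log_self one_lt_two n
        rw [h2, pow_succ] at h3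
        omega
      · exact_mod_cast hky.trans (hrough p hp hpn).le
  rw [div_le_iff₀ hφ]
  calc ∑ χ : DirichletCharacter ℂ q, SA χ 𝒜 ^ (2 * k)
      ≤ ∑ χ : DirichletCharacter ℂ q, ∑ j ∈ Finset.range J, (a j)⁻¹ ^ (2 * k) *
          SA χ (𝒜.filter fun n => Nat.log 2 n - i₀ = j) ^ (2 * k) :=
        Finset.sum_le_sum fun χ _ => pow_le_sum_inv_weight_mul_pow (SA_nonneg _ _) ha
          (fun j => SA_nonneg _ _) hsum hJ0 (SA_le_sum_fiberwise χ 𝒜 _ hmap)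
    _ = ∑ j ∈ Finset.range J, (a j)⁻¹ ^ (2 * k) * ∑ χ : DirichletCharacter ℂ q,
          SA χ (𝒜.filter fun n => Nat.log 2 n - i₀ = j) ^ (2 * k) := by
        rw [Finset.sum_comm]
        simp only [Finset.mul_sum]
    _ ≤ ∑ j ∈ Finset.range J, (a j)⁻¹ ^ (2 * k) * (q.totient * (400 ^ k *
          ((q : ℝ) ^ (-(113 : ℝ) / 1000) + ((2 : ℝ) ^ (i₀ + j)) ^ (-(k : ℝ) / 20)))) :=
        Finset.sum_le_sum fun j hj => mul_le_mul_of_nonneg_left (hblock j hj)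
          (pow_nonneg (inv_nonneg.2 (ha j).le) _)
    _ = (∑ j ∈ Finset.range J, (a j)⁻¹ ^ (2 * k) *
            (400 ^ k * ((2 : ℝ) ^ (i₀ + j)) ^ (-(k : ℝ) / 20)) +
          ∑ j ∈ Finset.range J, (a j)⁻¹ ^ (2 * k) *
            (400 ^ k * (q : ℝ) ^ (-(113 : ℝ) / 1000))) * q.totient := by
        rw [← Finset.sum_add_distrib, Finset.sum_mul]
        exact Finset.sum_congr rfl fun j _ => by ring
    _ ≤ _ := by
        refine mul_le_mul_of_nonneg_right (add_le_add ?_ ?_) hφ.le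
        · refine sum_weighted_block_le hρ (by linarith) (by omega) J a
            (fun j => (2 : ℝ) ^ (i₀ + j)) (fun j => ?_) ha (by linarith) haρ
          rw [pow_add]
          have : (0 : ℝ) < 2 ^ j := by positivity
          nlinarith
        · exact sum_weighted_offDiag_le hk hkq hJL a ha haJ

/-- A power of `y` beats the corresponding power of `log y`, uniformly for `k ^ 3 ≤ y`. -/
theorem exists_log_pow_le_mul_rpow :
    ∃ C : ℝ, 0 < C ∧ ∀ (k : ℕ) (y : ℝ), 1 ≤ k → (k : ℝ) ^ 3 ≤ y →
      Real.log y ^ (40 * k) ≤ C * y ^ ((k : ℝ) / 21) := by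
  obtain ⟨C, hC, h⟩ := exists_pow_le_mul_rpow (K := 1680 ^ 40) (ε := 1 / 42) (by norm_num)
    (by norm_num)
  refine ⟨C, hC, fun k y hk hy => ?_⟩
  have hk1 : (1 : ℝ) ≤ k := by exact_mod_cast hk
  have hy1 : 1 ≤ y := (one_le_pow₀ hk1).trans hy
  have hy0 : 0 < y := by linarith
  have hlog : Real.log y ≤ 1680 * y ^ ((1 : ℝ) / 1680) := by
    have := Real.log_le_rpow_div hy0.le (show (0 : ℝ) < 1 / 1680 by norm_num)
    linarith
  calc Real.log y ^ (40 * k) ≤ (1680 * y ^ ((1 : ℝ) / 1680)) ^ (40 * k) :=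
        pow_le_pow_left₀ (Real.log_nonneg hy1) hlog _
    _ = (1680 ^ 40) ^ k * y ^ ((k : ℝ) / 42) := by
        rw [mul_pow, pow_mul, ← Real.rpow_natCast (y ^ ((1 : ℝ) / 1680)), ← Real.rpow_mul hy0.le]
        congr 2
        push_cast
        ring
    _ ≤ (C * y ^ (1 / 42 * (k : ℝ))) * y ^ ((k : ℝ) / 42) := by
        gcongr
        exact h k y hk hy
    _ = _ := by
        rw [mul_assoc, ← Real.rpow_add hy0]
        congr 2
        ring

/-- Proposition 1: moments of `S_𝒜` for large rough `𝒜`. -/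
theorem moment_bound_rough_large :
    ∃ C : ℝ, 0 < C ∧
      ∀ q k : ℕ, 3 ≤ k → (k : ℝ) ≤ Real.log q / (400 * Real.log (Real.log q)) →
        ∀ y z : ℝ, (k : ℝ) ^ 3 ≤ y → y ≤ z → z ≤ (q : ℝ) ^ ((11 : ℝ) / 21) →
          ∀ 𝒜 : Finset ℕ,
            (∀ n ∈ 𝒜, y < (n : ℝ) ∧ (n : ℝ) ≤ z ∧
              ∀ p : ℕ, p.Prime → p ∣ n → y < (p : ℝ)) →
            (∑ χ : DirichletCharacter ℂ q, SA χ 𝒜 ^ (2 * k)) / q.totient ≤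
                C * (y ^ (-(k : ℝ) / 21) + (q : ℝ) ^ (-(1 : ℝ) / 10)) ∧
            (∑ χ : DirichletCharacter ℂ q, SA χ 𝒜 ^ (2 * k)) / q.totient ≤
                C / Real.log y ^ (40 * k) := by
  obtain ⟨K, D, hK, hD, hmoment⟩ := exists_moment_le_pow_mul_rpow
  obtain ⟨C₁, hC₁, habsorb⟩ := exists_pow_le_mul_rpow hK (show (0 : ℝ) < 1 / 420 by norm_num)
  obtain ⟨C₂, hC₂, hlogpow⟩ := exists_log_pow_le_mul_rpow
  refine ⟨(D * C₁ + 1) * (C₂ + 1), by positivity, ?_⟩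
  intro q k hk hkq y z hky hyz hzq 𝒜 h𝒜
  have hk' : (3 : ℝ) ≤ k := by exact_mod_cast hk
  have hy27 : 27 ≤ y := by
    calc (27 : ℝ) = 3 ^ 3 := by norm_num
      _ ≤ (k : ℝ) ^ 3 := by gcongr
      _ ≤ y := hky
  have hy0 : 0 < y := by linarith
  have hlogy : 0 < Real.log y := Real.log_pos (by linarith)
  obtain ⟨hL, -⟩ := le_log_of_le_div_loglog hk hkq
  have hq0 : (0 : ℝ) < q := by
    refine Nat.cast_pos.2 (Nat.pos_of_ne_zero ?_)
    rintro rfl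
    norm_num at hL
  set Y := y ^ (-(k : ℝ) / 21) with hY
  set Q := (q : ℝ) ^ (-(1 : ℝ) / 10) with hQ
  have hY0 : 0 < Y := by positivity
  have hQ0 : 0 < Q := by positivity
  have hfirst : (∑ χ : DirichletCharacter ℂ q, SA χ 𝒜 ^ (2 * k)) / q.totient ≤
      (D * C₁ + 1) * (Y + Q) := by
    refine (hmoment q k hk hkq y z hky hyz hzq 𝒜 h𝒜).trans ?_
    have hKY : K ^ k * y ^ (-(k : ℝ) / 20) ≤ C₁ * Y := by
      calc K ^ k * y ^ (-(k : ℝ) / 20) ≤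
            (C₁ * y ^ (1 / 420 * (k : ℝ))) * y ^ (-(k : ℝ) / 20) := by
            gcongr
            exact habsorb k y (by omega) hky
        _ = C₁ * Y := by
            rw [mul_assoc, ← Real.rpow_add hy0, hY]
            congr 2
            ring
    calc D * (K ^ k * y ^ (-(k : ℝ) / 20)) + Q ≤ D * (C₁ * Y) + Q := by gcongr
      _ ≤ (D * C₁ + 1) * (Y + Q) := by nlinarith [mul_pos (mul_pos hD hC₁) hQ0]
  refine ⟨hfirst.trans ?_, hfirst.trans ?_⟩
  · gcongr
    exact le_mul_of_one_le_right (by positivity) (by linarith)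
  · have hYlog : Y * Real.log y ^ (40 * k) ≤ C₂ := by
      calc Y * Real.log y ^ (40 * k) ≤ Y * (C₂ * y ^ ((k : ℝ) / 21)) := by
            gcongr
            exact hlogpow k y (by omega) hky
        _ = C₂ * y ^ (-(k : ℝ) / 21 + (k : ℝ) / 21) := by rw [Real.rpow_add hy0, hY]; ring
        _ = C₂ := by rw [neg_div, neg_add_cancel, Real.rpow_zero, mul_one]
    have hQlog : Q * Real.log y ^ (40 * k) ≤ 1 := by
      have hyq : Real.log y ≤ Real.log q := by
        have h1 : Real.log y ≤ 11 / 21 * Real.log q := by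
          rw [← Real.log_rpow hq0]
          exact Real.log_le_log hy0 (hyz.trans hzq)
        linarith
      calc Q * Real.log y ^ (40 * k) ≤ Q * Real.log q ^ (40 * k) := by gcongr
        _ ≤ Q * (q : ℝ) ^ (((40 : ℕ) : ℝ) / 400) := by
            gcongr
            exact log_pow_le_rpow hk hkq 40
        _ = 1 := by rw [hQ, ← Real.rpow_add hq0]; norm_num
    rw [le_div_iff₀ (by positivity), mul_assoc]
    gcongr
    linarith
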